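/- arXiv:1706.07302 — 8 statements merged into one kernel-verified Lean document; each statement's English description precedes it below -/
import Mathlib

section
/- If f : E → ℝ is differentiable, uniformly Fréchet differentiable on bounded subsets of E (i.e., for every bounded set B ⊆ E and every ε > 0 there exists δ > 0 such that |(f(x + ty) − f(x))/t − ⟨∇f(x), y⟩| ≤ ε for all x ∈ B, all y with ‖y‖ = 1 and all 0 < t < δ), and bounded on bounded subsets of E, then ∇f is uniformly continuous on bounded subsets of E from the norm topology of E to the norm topology of E* (i.e., for every bounded set B and ε > 0 there is δ > 0 with ‖∇f(x) − ∇f(y)‖ ≤ ε whenever x, y ∈ B and ‖x − y‖ ≤ δ). -/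
open Bornology

/-- If `f` is bounded on bounded sets and its difference quotients converge to `f'` uniformly on
bounded sets, then `f'` is bounded on balls. -/
theorem exists_norm_le_of_uniform_differentiable
    {E : Type*} [NormedAddCommGroup E] [NormedSpace ℝ E]
    (f : E → ℝ) (f' : E → (E →L[ℝ] ℝ))
    (hUF : ∀ B : Set E, IsBounded B → ∀ ε > (0:ℝ), ∃ δ > (0:ℝ),
      ∀ x ∈ B, ∀ y : E, ‖y‖ = 1 → ∀ t : ℝ, 0 < t → t < δ →
        |(f (x + t • y) - f x) / t - f' x y| ≤ ε)
    (hbdd : ∀ B : Set E, IsBounded B → IsBounded (f '' B)) (R : ℝ) :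
    ∃ C > (0:ℝ), ∀ x ∈ Metric.closedBall (0 : E) R, ‖f' x‖ ≤ C := by
  obtain ⟨δ, hδ, H⟩ := hUF _ (Metric.isBounded_closedBall (x := (0 : E)) (r := R)) 1 one_pos
  obtain ⟨t, ht, htδ⟩ := exists_between hδ
  obtain ⟨K, hK, hfK⟩ :=
    (hbdd _ (Metric.isBounded_closedBall (x := (0 : E)) (r := R + t))).exists_pos_norm_le
  have hf : ∀ z : E, ‖z‖ ≤ R + t → |f z| ≤ K := fun z hz =>
    hfK _ ⟨z, mem_closedBall_zero_iff.2 hz, rfl⟩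
  refine ⟨1 + 2 * K / t, by positivity, fun x hx => ?_⟩
  refine ContinuousLinearMap.opNorm_le_of_unit_norm (by positivity) fun v hv => ?_
  have hxR : ‖x‖ ≤ R := mem_closedBall_zero_iff.1 hx
  have htv : ‖t • v‖ = t := by rw [norm_smul, hv, mul_one, Real.norm_of_nonneg ht.le]
  have hquot : |(f (x + t • v) - f x) / t| ≤ 2 * K / t := by
    rw [abs_div, abs_of_pos ht]
    gcongr
    have h₁ := hf (x + t • v) ((norm_add_le _ _).trans (by linarith))
    have h₂ := hf x (by linarith)
    linarith [abs_sub (f (x + t • v)) (f x)]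
  have happrox := H x hx v hv t ht htδ
  rw [Real.norm_eq_abs]
  rw [abs_le] at *
  constructor <;> linarith

/-- If `f : E → ℝ` is differentiable, uniformly Fréchet differentiable on bounded
subsets of `E` and bounded on bounded subsets of `E`, then `∇f` is uniformly
continuous on bounded subsets of `E` from the norm topology of `E` to the norm
topology of `E*`. -/
theorem grad_uniformly_continuous_on_bounded_sets
    {E : Type*} [NormedAddCommGroup E] [NormedSpace ℝ E] [CompleteSpace E]
    (f : E → ℝ) (f' : E → (E →L[ℝ] ℝ))
    (hconv : ConvexOn ℝ Set.univ f)
    (hdiff : ∀ x : E, HasFDerivAt f (f' x) x)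
    (hUF : ∀ B : Set E, IsBounded B → ∀ ε > (0:ℝ), ∃ δ > (0:ℝ),
      ∀ x ∈ B, ∀ y : E, ‖y‖ = 1 → ∀ t : ℝ, 0 < t → t < δ →
        |(f (x + t • y) - f x) / t - f' x y| ≤ ε)
    (hbdd : ∀ B : Set E, IsBounded B → IsBounded (f '' B)) :
    ∀ B : Set E, IsBounded B → ∀ ε > (0:ℝ), ∃ δ > (0:ℝ),
      ∀ x ∈ B, ∀ y ∈ B, ‖x - y‖ ≤ δ → ‖f' x - f' y‖ ≤ ε := by
  intro B hB ε hε
  obtain ⟨R, hR⟩ := hB.subset_closedBall (0 : E)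
  obtain ⟨δ, hδ, H⟩ := hUF B hB (ε / 4) (by positivity)
  obtain ⟨t, ht, htδ⟩ := exists_between hδ
  obtain ⟨C, hC, hf'C⟩ := exists_norm_le_of_uniform_differentiable f f' hUF hbdd (R + t)
  have hLip : ∀ x y : E, ‖x‖ ≤ R + t → ‖y‖ ≤ R + t → |f x - f y| ≤ C * ‖x - y‖ :=
    fun x y hx hy => (convex_closedBall 0 (R + t)).norm_image_sub_le_of_norm_hasFDerivWithin_le
      (fun z _ => (hdiff z).hasFDerivWithinAt) hf'C
      (mem_closedBall_zero_iff.2 hy) (mem_closedBall_zero_iff.2 hx)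
  refine ⟨t * ε / (4 * C), by positivity, fun x hx y hy hxy => ?_⟩
  refine ContinuousLinearMap.opNorm_le_of_unit_norm hε.le fun v hv => ?_
  have hxR : ‖x‖ ≤ R := mem_closedBall_zero_iff.1 (hR hx)
  have hyR : ‖y‖ ≤ R := mem_closedBall_zero_iff.1 (hR hy)
  have htv : ‖t • v‖ = t := by rw [norm_smul, hv, mul_one, Real.norm_of_nonneg ht.le]
  have hCxy : C * ‖x - y‖ ≤ t * ε / 4 :=
    (mul_le_mul_of_nonneg_left hxy hC.le).trans_eq (by field_simp)
  have hbase := (hLip x y (by linarith) (by linarith)).trans hCxy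
  have hshift := hLip (x + t • v) (y + t • v) ((norm_add_le _ _).trans (by linarith))
    ((norm_add_le _ _).trans (by linarith))
  rw [add_sub_add_right_eq_sub] at hshift
  replace hshift := hshift.trans hCxy
  have hquot : |(f (x + t • v) - f x) / t - (f (y + t • v) - f y) / t| ≤ ε / 2 := by
    rw [← sub_div, abs_div, abs_of_pos ht, div_le_iff₀ ht]
    rw [abs_le] at *
    constructor <;> linarith
  have hx' := H x hx v hv t ht htδ
  have hy' := H y hy v hv t ht htδ
  rw [sub_apply, Real.norm_eq_abs]
  rw [abs_le] at *
  constructor <;> linarith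
end

section
/- Characterization of the Bregman projection: let C be a nonempty, closed and convex subset of E, x ∈ E, and z ∈ C. Then z is a Bregman projection of x onto C (i.e., D_f(z,x) = inf{D_f(y,x) : y ∈ C}) if and only if ⟨∇f(x) − ∇f(z), y − z⟩ ≤ 0 for all y ∈ C. -/
/-- The gradient inequality: a convex function lies above its tangent hyperplanes. -/
theorem ConvexOn.add_hasFDerivAt_le {E : Type*} [NormedAddCommGroup E] [NormedSpace ℝ E]
    {s : Set E} {f : E → ℝ} {f' : E →L[ℝ] ℝ} {a y : E} (hf : ConvexOn ℝ s f)
    (hf' : HasFDerivAt f f' a) (ha : a ∈ s) (hy : y ∈ s) :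
    f a + f' (y - a) ≤ f y := by
  have hline : HasDerivAt (f ∘ AffineMap.lineMap (k := ℝ) a y) (f' (y - a)) 0 := by
    refine HasFDerivAt.comp_hasDerivAt 0 ?_ AffineMap.hasDerivAt_lineMap
    simpa using hf'
  have hslope := (hf.comp_affineMap (AffineMap.lineMap a y)).le_slope_of_hasDerivAt
    (x := 0) (y := 1) (by simpa using ha) (by simpa using hy) one_pos hline
  simp only [slope_def_field, Function.comp_apply, AffineMap.lineMap_apply_zero,
    AffineMap.lineMap_apply_one, sub_zero, div_one] at hslope
  linarith

/-- Characterization of the Bregman projection: let `C` be a nonempty, closed and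
convex subset of `E`, `x ∈ E`, and `z ∈ C`.  Then `z` is a Bregman projection of
`x` onto `C` (i.e. `z` minimizes `y ↦ D_f(y,x)` over `C`) if and only if
`⟨∇f(x) − ∇f(z), y − z⟩ ≤ 0` for all `y ∈ C`. -/
theorem bregman_projection_characterization
    {E : Type*} [NormedAddCommGroup E] [NormedSpace ℝ E] [CompleteSpace E]
    (f : E → ℝ) (f' : E → (E →L[ℝ] ℝ))
    (hconv : ConvexOn ℝ Set.univ f)
    (hdiff : ∀ x : E, HasFDerivAt f (f' x) x)
    (D : E → E → ℝ)
    (hD : ∀ y x : E, D y x = f y - f x - f' x (y - x))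
    (C : Set E) (hCne : C.Nonempty) (hCclosed : IsClosed C) (hCconv : Convex ℝ C)
    (x : E) (z : E) (hz : z ∈ C) :
    IsLeast ((fun y => D y x) '' C) (D z x) ↔
      ∀ y ∈ C, (f' x - f' z) (y - z) ≤ 0 := by
  constructor
  · rintro ⟨-, hmin⟩ y hy
    have hlocal : IsLocalMinOn (fun y => D y x) C z :=
      IsMinOn.localize fun y hy => hmin (Set.mem_image_of_mem _ hy)
    have hderiv : HasFDerivAt (fun y => D y x) (f' z - f' x) z := by
      simp only [hD]
      exact ((hdiff z).sub_const (f x)).sub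
        ((f' x).hasFDerivAt.comp z ((hasFDerivAt_id z).sub_const x))
    have hnonneg := hlocal.hasFDerivWithinAt_nonneg hderiv.hasFDerivWithinAt
      (sub_mem_posTangentConeAt_of_segment_subset (hCconv.segment_subset hz hy))
    simp only [sub_apply] at hnonneg ⊢
    linarith
  · refine fun h => ⟨Set.mem_image_of_mem _ hz, ?_⟩
    rintro _ ⟨y, hy, rfl⟩
    have hgrad := hconv.add_hasFDerivAt_le (hdiff z) (Set.mem_univ z) (Set.mem_univ y)
    have hvar := h y hy
    simp only [sub_apply, map_sub, hD] at hgrad hvar ⊢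
    linarith
end

section
/- Bregman projection inequality: let C be a nonempty, closed and convex subset of E, x ∈ E, and let z ∈ C be a Bregman projection of x onto C (i.e., D_f(z,x) = inf{D_f(w,x) : w ∈ C}). Then D_f(y,z) + D_f(z,x) ≤ D_f(y,x) for every y ∈ C. -/
/-- Bregman projection inequality: if `z ∈ C` is a Bregman projection of `x` onto the
nonempty closed convex set `C` (i.e. `z` minimizes `w ↦ D_f(w,x)` over `C`), then
`D_f(y,z) + D_f(z,x) ≤ D_f(y,x)` for every `y ∈ C`. -/
theorem bregman_projection_inequality
    {E : Type*} [NormedAddCommGroup E] [NormedSpace ℝ E] [CompleteSpace E]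
    (f : E → ℝ) (f' : E → (E →L[ℝ] ℝ))
    (hconv : ConvexOn ℝ Set.univ f)
    (hdiff : ∀ x : E, HasFDerivAt f (f' x) x)
    (D : E → E → ℝ)
    (hD : ∀ y x : E, D y x = f y - f x - f' x (y - x))
    (C : Set E) (hCne : C.Nonempty) (hCclosed : IsClosed C) (hCconv : Convex ℝ C)
    (x : E) (z : E) (hz : z ∈ C)
    (hproj : IsLeast ((fun w => D w x) '' C) (D z x)) :
    ∀ y ∈ C, D y z + D z x ≤ D y x := by
  intro y hy
  have hmin : IsMinOn (fun w => f w - f' x w) C z := fun w hw => by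
    have h : D z x ≤ D w x := hproj.2 ⟨w, hw, rfl⟩
    simp only [hD, map_sub] at h
    simp only [Set.mem_ofPred_eq]
    linarith
  have hderiv : HasFDerivAt (fun w => f w - f' x w) (f' z - f' x) z :=
    (hdiff z).sub (f' x).hasFDerivAt
  have hvar : 0 ≤ (f' z - f' x) (y - z) :=
    hmin.localize.hasFDerivWithinAt_nonneg hderiv.hasFDerivWithinAt
      (sub_mem_posTangentConeAt_of_segment_subset (hCconv.segment_subset hz hy))
  simp only [sub_apply, map_sub] at hvar
  simp only [hD, map_sub]
  linarith
end

section
/- Let E be reflexive, f totally convex, x₀ ∈ E, and C a nonempty, closed and convex subset of E. Let p ∈ C be a Bregman projection of x₀ onto C (i.e., D_f(p,x₀) = inf{D_f(y,x₀) : y ∈ C}). Suppose (x_n) is a bounded sequence in E such that every weak subsequential limit of (x_n) belongs to C, and D_f(x_n, x₀) ≤ D_f(p, x₀) for every n. Then (x_n) converges strongly (in norm) to p. -/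
open Filter Topology Bornology

section WeakCompactness

variable {E : Type*} [NormedAddCommGroup E] [NormedSpace ℝ E]

/-- In a reflexive space a bounded family converges weakly along every ultrafilter. -/
theorem exists_weak_limit_ultrafilter
    (hrefl : Function.Surjective (NormedSpace.inclusionInDoubleDual ℝ E))
    {ι : Type*} {x : ι → E} (hx : IsBounded (Set.range x)) (U : Ultrafilter ι) :
    ∃ q : E, ∀ ℓ : E →L[ℝ] ℝ, Tendsto (fun n => ℓ (x n)) U (𝓝 (ℓ q)) := by
  obtain ⟨R, hR⟩ := hx.exists_norm_le
  let J : ι → WeakDual ℝ (E →L[ℝ] ℝ) := fun n =>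
    StrongDual.toWeakDual (NormedSpace.inclusionInDoubleDual ℝ E (x n))
  have hJ : ∀ n, J n ∈ WeakDual.toStrongDual ⁻¹'
      Metric.closedBall (0 : StrongDual ℝ (E →L[ℝ] ℝ)) R := fun n => by
    have hnorm : ‖NormedSpace.inclusionInDoubleDual ℝ E (x n)‖ ≤ R :=
      (NormedSpace.double_dual_bound ℝ E (x n)).trans (hR _ ⟨n, rfl⟩)
    exact (dist_zero_right (E := StrongDual ℝ (StrongDual ℝ E)) _).trans_le hnorm
  obtain ⟨z, -, hz⟩ := (WeakDual.isCompact_closedBall (𝕜 := ℝ) (0 : StrongDual ℝ (E →L[ℝ] ℝ)) R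
    ).ultrafilter_le_nhds (U.map J) (le_principal_iff.2 (Ultrafilter.mem_map.2
      (Filter.univ_mem' hJ)))
  obtain ⟨q, hq⟩ := hrefl (WeakDual.toStrongDual z)
  refine ⟨q, fun ℓ => ?_⟩
  have hev : Tendsto (fun n => J n ℓ) U (𝓝 (z ℓ)) :=
    ((WeakDual.eval_continuous ℓ).tendsto z).comp hz
  have hzq : z ℓ = ℓ q := (DFunLike.congr_fun hq ℓ).symm
  rw [hzq] at hev
  exact hev

/-- A closed convex set contains the weak limits of nets lying in it. -/
theorem mem_of_weak_limit_of_isClosed_of_convex {ι : Type*} {l : Filter ι} [l.NeBot]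
    {x : ι → E} {q : E} {K : Set E} (hK : IsClosed K) (hKc : Convex ℝ K) (hx : ∀ n, x n ∈ K)
    (hq : ∀ ℓ : E →L[ℝ] ℝ, Tendsto (fun n => ℓ (x n)) l (𝓝 (ℓ q))) : q ∈ K := by
  by_contra hqK
  obtain ⟨ℓ, u, hu, huq⟩ := geometric_hahn_banach_closed_point hKc hK hqK
  exact (le_of_tendsto (hq ℓ) (Eventually.of_forall fun n => (hu _ (hx n)).le)).not_gt huq

/-- Countably many functionals separate the points of a separable subspace. -/
theorem exists_seq_dual_separating (Y : Submodule ℝ E)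
    (hY : TopologicalSpace.IsSeparable (Y : Set E)) :
    ∃ g : ℕ → (E →L[ℝ] ℝ), ∀ y ∈ Y, (∀ k, g k y = 0) → y = 0 := by
  obtain ⟨c, hc, hYc⟩ := hY
  have hne : c.Nonempty := closure_nonempty_iff.1 ⟨0, hYc Y.zero_mem⟩
  obtain ⟨d, rfl⟩ := hc.exists_eq_range hne
  choose g hg hgd using fun k => exists_dual_vector'' ℝ (d k)
  refine ⟨g, fun y hy h0 => norm_le_zero_iff.1 (le_of_forall_pos_le_add fun ε hε => ?_)⟩
  obtain ⟨_, ⟨k, rfl⟩, hk⟩ := Metric.mem_closure_iff.1 (hYc hy) (ε / 2) (half_pos hε)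
  rw [dist_eq_norm] at hk
  have hdk : ‖d k‖ ≤ ‖y - d k‖ := by
    have h := (g k).le_of_opNorm_le (hg k) (y - d k)
    rw [map_sub, h0 k, hgd k] at h
    simpa using h
  have htri := norm_le_norm_add_norm_sub (d k) y
  rw [norm_sub_rev] at htri
  linarith

/-- In a reflexive space every bounded sequence has a weakly convergent subsequence. -/
theorem exists_weakly_convergent_subseq
    (hrefl : Function.Surjective (NormedSpace.inclusionInDoubleDual ℝ E))
    {x : ℕ → E} (hx : IsBounded (Set.range x)) :
    ∃ (q : E) (φ : ℕ → ℕ), StrictMono φ ∧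
      ∀ ℓ : E →L[ℝ] ℝ, Tendsto (fun n => ℓ (x (φ n))) atTop (𝓝 (ℓ q)) := by
  let Y : Submodule ℝ E := (Submodule.span ℝ (Set.range x)).topologicalClosure
  have hYsep : TopologicalSpace.IsSeparable (Y : Set E) :=
    ((Set.countable_range x).isSeparable.span (R := ℝ)).closure
  have hYclosed : IsClosed (Y : Set E) := Submodule.isClosed_topologicalClosure _
  have hxY : ∀ n, x n ∈ Y := fun n =>
    Submodule.le_topologicalClosure _ (Submodule.subset_span ⟨n, rfl⟩)
  obtain ⟨g, hg⟩ := exists_seq_dual_separating Y hYsep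
  obtain ⟨q, hq⟩ := exists_weak_limit_ultrafilter hrefl hx (hyperfilter ℕ)
  have hqY : q ∈ Y := mem_of_weak_limit_of_isClosed_of_convex hYclosed Y.convex hxY hq
  have hfreq : ∀ n : ℕ, ∃ᶠ m in atTop, ∀ k ∈ Finset.range (n + 1),
      dist (g k (x m)) (g k q) < 1 / ((n : ℝ) + 1) := fun n => by
    have hev : ∀ᶠ m in (hyperfilter ℕ : Filter ℕ), ∀ k ∈ Finset.range (n + 1),
        dist (g k (x m)) (g k q) < 1 / ((n : ℝ) + 1) :=
      (Finset.eventually_all _).2 fun k _ =>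
        (hq (g k)).eventually (Metric.ball_mem_nhds _ Nat.one_div_pos_of_nat)
    exact hev.frequently.filter_mono Nat.hyperfilter_le_atTop
  obtain ⟨φ, hφ, hφg⟩ := extraction_forall_of_frequently hfreq
  have hgt : ∀ k, Tendsto (fun n => g k (x (φ n))) atTop (𝓝 (g k q)) := fun k => by
    refine tendsto_iff_dist_tendsto_zero.2 (squeeze_zero' (Eventually.of_forall fun _ =>
      dist_nonneg) ?_ tendsto_one_div_add_atTop_nhds_zero_nat)
    filter_upwards [eventually_ge_atTop k] with n hn
    exact (hφg n k (Finset.mem_range.2 (Nat.lt_succ_of_le hn))).le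
  refine ⟨q, φ, hφ, fun ℓ => (tendsto_iff_ultrafilter _ _ _).2 fun V hV => ?_⟩
  obtain ⟨q', hq'⟩ := exists_weak_limit_ultrafilter hrefl
    (x := x ∘ φ) (hx.subset (Set.range_comp_subset_range φ x)) V
  have hq'Y : q' ∈ Y :=
    mem_of_weak_limit_of_isClosed_of_convex hYclosed Y.convex (fun n => hxY (φ n)) hq'
  have heq : q' = q := sub_eq_zero.1 <| hg _ (Y.sub_mem hq'Y hqY) fun k => by
    rw [map_sub, sub_eq_zero]
    exact tendsto_nhds_unique (hq' (g k)) ((hgt k).mono_left hV)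
  exact heq ▸ hq' ℓ

end WeakCompactness

section Bregman

variable {E : Type*} [NormedAddCommGroup E] [NormedSpace ℝ E]

/-- A convex differentiable function lies above its tangents. -/
theorem ConvexOn.add_le_of_hasFDerivAt {f : E → ℝ} {g : E →L[ℝ] ℝ} {a : E}
    (hf : ConvexOn ℝ Set.univ f) (hg : HasFDerivAt f g a) (y : E) :
    f a + g (y - a) ≤ f y := by
  have hline : HasDerivAt (fun t : ℝ => AffineMap.lineMap a y t) (y - a) 0 :=
    AffineMap.hasDerivAt_lineMap
  have hder : HasDerivAt (f ∘ fun t : ℝ => AffineMap.lineMap a y t) (g (y - a)) 0 :=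
    HasFDerivAt.comp_hasDerivAt 0 (by simpa using hg) hline
  have hconv : ConvexOn ℝ Set.univ (f ∘ (AffineMap.lineMap a y : ℝ →ᵃ[ℝ] E)) := by
    simpa using hf.comp_affineMap (AffineMap.lineMap a y : ℝ →ᵃ[ℝ] E)
  have h := hconv.le_slope_of_hasDerivAt (Set.mem_univ 0) (Set.mem_univ 1) one_pos hder
  simp only [slope_def_field, Function.comp_apply, AffineMap.lineMap_apply_zero,
    AffineMap.lineMap_apply_one, sub_zero, div_one] at h
  linarith

/-- The modulus of total convexity at `a` bounds the Bregman distance from below outside a ball. -/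
theorem modulus_le_bregman {f : E → ℝ} {g : E →L[ℝ] ℝ} {a : E}
    (hf : ConvexOn ℝ Set.univ f) (hg : HasFDerivAt f g a) {t : ℝ} (ht : 0 < t) {y : E}
    (hy : t ≤ ‖y - a‖) :
    sInf {d : ℝ | ∃ z : E, ‖z - a‖ = t ∧ d = f z - f a - g (z - a)} ≤
      f y - f a - g (y - a) := by
  have hnonneg : ∀ z, 0 ≤ f z - f a - g (z - a) := fun z => by
    linarith [hf.add_le_of_hasFDerivAt hg z]
  have hpos : 0 < ‖y - a‖ := ht.trans_le hy
  have hs1 : t / ‖y - a‖ ≤ 1 := (div_le_one hpos).2 hy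
  have hs0 : 0 ≤ t / ‖y - a‖ := by positivity
  set s := t / ‖y - a‖ with hs
  have hsub : a + s • (y - a) - a = s • (y - a) := add_sub_cancel_left _ _
  refine le_trans (b := f (a + s • (y - a)) - f a - g (a + s • (y - a) - a))
    (csInf_le ⟨0, ?_⟩ ⟨a + s • (y - a), ?_, rfl⟩) ?_
  · rintro _ ⟨z, -, rfl⟩
    exact hnonneg z
  · rw [hsub, norm_smul, Real.norm_of_nonneg hs0, hs, div_mul_cancel₀ _ hpos.ne']
  · have hc := hf.2 (Set.mem_univ a) (Set.mem_univ y) (sub_nonneg.2 hs1) hs0 (by ring)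
    have hz : (1 - s) • a + s • y = a + s • (y - a) := by module
    rw [hz, smul_eq_mul, smul_eq_mul] at hc
    rw [hsub, map_smul, smul_eq_mul]
    nlinarith [mul_nonneg (sub_nonneg.2 hs1) (hnonneg y)]

end Bregman

/-- Let `E` be reflexive, `f` totally convex, `x₀ ∈ E`, and `C` a nonempty closed
convex subset of `E`.  Let `p ∈ C` be a Bregman projection of `x₀` onto `C`.  If
`(x_n)` is a bounded sequence in `E` every weak subsequential limit of which lies
in `C`, and `D_f(x_n, x₀) ≤ D_f(p, x₀)` for every `n`, then `x_n → p` in norm. -/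
theorem strong_convergence_to_bregman_projection
    {E : Type*} [NormedAddCommGroup E] [NormedSpace ℝ E] [CompleteSpace E]
    (hrefl : Function.Surjective (NormedSpace.inclusionInDoubleDual ℝ E))
    (f : E → ℝ) (f' : E → (E →L[ℝ] ℝ))
    (hconv : ConvexOn ℝ Set.univ f)
    (hdiff : ∀ x : E, HasFDerivAt f (f' x) x)
    (D : E → E → ℝ)
    (hD : ∀ y x : E, D y x = f y - f x - f' x (y - x))
    (htc : ∀ x : E, ∀ t : ℝ, 0 < t →
      0 < sInf {d : ℝ | ∃ y : E, ‖y - x‖ = t ∧ d = D y x})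
    (x₀ : E)
    (C : Set E) (hCne : C.Nonempty) (hCclosed : IsClosed C) (hCconv : Convex ℝ C)
    (p : E) (hp : p ∈ C)
    (hproj : IsLeast ((fun y => D y x₀) '' C) (D p x₀))
    (x : ℕ → E) (hxbdd : IsBounded (Set.range x))
    (hweak : ∀ (q : E) (φ : ℕ → ℕ), StrictMono φ →
      (∀ ℓ : E →L[ℝ] ℝ, Tendsto (fun n => ℓ (x (φ n))) atTop (𝓝 (ℓ q))) → q ∈ C)
    (hle : ∀ n : ℕ, D (x n) x₀ ≤ D p x₀) :
    Tendsto x atTop (𝓝 p) := by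
  obtain rfl : D = fun y x => f y - f x - f' x (y - x) := by
    funext y x
    exact hD y x
  have hmod : ∀ (a y : E) (t : ℝ), 0 < t → t ≤ ‖y - a‖ →
      sInf {d : ℝ | ∃ z : E, ‖z - a‖ = t ∧ d = f z - f a - f' a (z - a)} ≤
        f y - f a - f' a (y - a) :=
    fun a y t ht hy => modulus_le_bregman hconv (hdiff a) ht hy
  have hmin : ∀ y ∈ C, f p - f x₀ - f' x₀ (p - x₀) ≤ f y - f x₀ - f' x₀ (y - x₀) :=
    fun y hy => hproj.2 ⟨y, hy, rfl⟩
  -- the Bregman projection is unique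
  have huniq : ∀ q ∈ C, f q - f x₀ - f' x₀ (q - x₀) ≤ f p - f x₀ - f' x₀ (p - x₀) → q = p := by
    intro q hq hqp
    by_contra hne
    let m : E := midpoint ℝ p q
    have hm := hmin m (hCconv.midpoint_mem hp hq)
    have hpos : ∀ y, y ≠ m → 0 < f y - f m - f' m (y - m) := fun y hy =>
      (htc m _ (norm_pos_iff.2 (sub_ne_zero.2 hy))).trans_le
        (hmod m y _ (norm_pos_iff.2 (sub_ne_zero.2 hy)) le_rfl)
    have h1 := hpos p (fun h => hne ((left_eq_midpoint_iff ℝ).1 h).symm)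
    have h2 := hpos q (fun h => hne ((right_eq_midpoint_iff ℝ).1 h).symm)
    have hm2 : p + q = m + m := (midpoint_add_self ℝ p q).symm
    have e1 := congrArg (f' m) hm2
    have e2 := congrArg (f' x₀) hm2
    simp only [map_add, map_sub] at *
    linarith
  refine tendsto_of_subseq_tendsto fun ns hns => ?_
  obtain ⟨σ, -, hσ⟩ := strictMono_subseq_of_tendsto_atTop hns
  obtain ⟨q, ψ, hψ, hq⟩ := exists_weakly_convergent_subseq hrefl
    (x := x ∘ ns ∘ σ) (hxbdd.subset (Set.range_comp_subset_range _ x))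
  have hqC : q ∈ C := hweak q ((ns ∘ σ) ∘ ψ) (hσ.comp hψ) hq
  refine ⟨σ ∘ ψ, ?_⟩
  set y : ℕ → E := fun n => x (ns ((σ ∘ ψ) n))
  have hyq : ∀ ℓ : E →L[ℝ] ℝ, Tendsto (fun n => ℓ (y n)) atTop (𝓝 (ℓ q)) := hq
  have hyle : ∀ n, f (y n) - f x₀ - f' x₀ (y n - x₀) ≤ f p - f x₀ - f' x₀ (p - x₀) :=
    fun n => hle _
  have hqle : f q - f x₀ - f' x₀ (q - x₀) ≤ f p - f x₀ - f' x₀ (p - x₀) := by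
    have hlim : Tendsto (fun n => f q - f x₀ - f' x₀ (q - x₀) +
        ((f' q - f' x₀) (y n) - (f' q - f' x₀) q)) atTop
        (𝓝 (f q - f x₀ - f' x₀ (q - x₀))) := by
      simpa using ((hyq (f' q - f' x₀)).sub_const ((f' q - f' x₀) q)).const_add
        (f q - f x₀ - f' x₀ (q - x₀))
    refine le_of_tendsto hlim (Eventually.of_forall fun n => ?_)
    have h1 := hconv.add_le_of_hasFDerivAt (hdiff q) (y n)
    have h2 := hyle n
    simp only [map_sub, sub_apply] at *
    linarith
  obtain rfl := huniq q hqC hqle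
  have hzero : Tendsto (fun n => (f' x₀ - f' q) (y n) - (f' x₀ - f' q) q) atTop (𝓝 0) := by
    simpa using (hyq (f' x₀ - f' q)).sub_const ((f' x₀ - f' q) q)
  refine Metric.tendsto_nhds.2 fun ε hε => ?_
  filter_upwards [hzero.eventually (gt_mem_nhds (htc q ε hε))] with n hn
  rw [dist_eq_norm]
  by_contra! hge
  have h1 := hmod q (y n) ε hε hge
  have h2 := hyle n
  have h3 : f (y n) - f q - f' q (y n - q) ≤ (f' x₀ - f' q) (y n) - (f' x₀ - f' q) q := by
    simp only [map_sub, sub_apply] at *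
    linarith
  exact (h1.trans h3).not_gt hn
end

section
/- Joint convexity inequality for the Bregman distance: suppose the gradient map ∇f : E → E* is a bijection and let ∇f* : E* → E denote its inverse. Then for every z ∈ E, every finite family x₁, …, x_N ∈ E and every t₁, …, t_N ≥ 0 with Σ_{i=1}^N t_i = 1, one has D_f(z, ∇f*(Σ_{i=1}^N t_i ∇f(x_i))) ≤ Σ_{i=1}^N t_i D_f(z, x_i). -/
/-- Gradient inequality: a convex function lies above its tangent hyperplanes. -/
theorem ConvexOn.add_fderiv_le {E : Type*} [NormedAddCommGroup E] [NormedSpace ℝ E]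
    {f : E → ℝ} (hf : ConvexOn ℝ Set.univ f) {f' : E →L[ℝ] ℝ} {x : E}
    (hx : HasFDerivAt f f' x) (y : E) : f x + f' (y - x) ≤ f y := by
  have hconv : ConvexOn ℝ Set.univ (f ∘ AffineMap.lineMap (k := ℝ) x y) :=
    hf.comp_affineMap (AffineMap.lineMap x y)
  have hderiv : HasDerivAt (f ∘ AffineMap.lineMap (k := ℝ) x y) (f' (y - x)) 0 := by
    refine HasFDerivAt.comp_hasDerivAt (0 : ℝ) ?_ AffineMap.hasDerivAt_lineMap
    simpa using hx
  have h := hconv.le_slope_of_hasDerivAt (Set.mem_univ 0) (Set.mem_univ 1) zero_lt_one hderiv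
  simp only [slope_def_field, Function.comp_apply, AffineMap.lineMap_apply_one,
    AffineMap.lineMap_apply_zero, sub_zero, div_one] at h
  linarith

/-- Joint convexity inequality for the Bregman distance: if the gradient map
`∇f : E → E*` is a bijection with inverse `∇f* : E* → E`, then for every `z ∈ E`,
every finite family `x₁, …, x_N ∈ E` and every `t₁, …, t_N ≥ 0` with `∑ tᵢ = 1`,
`D_f(z, ∇f*(∑ tᵢ ∇f(xᵢ))) ≤ ∑ tᵢ D_f(z, xᵢ)`. -/
theorem bregman_distance_convexity
    {E : Type*} [NormedAddCommGroup E] [NormedSpace ℝ E] [CompleteSpace E]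
    (hrefl : Function.Surjective (NormedSpace.inclusionInDoubleDual ℝ E))
    (f : E → ℝ) (f' : E → (E →L[ℝ] ℝ))
    (hconv : ConvexOn ℝ Set.univ f)
    (hdiff : ∀ x : E, HasFDerivAt f (f' x) x)
    (D : E → E → ℝ)
    (hD : ∀ y x : E, D y x = f y - f x - f' x (y - x))
    (hbij : Function.Bijective f')
    (gstar : (E →L[ℝ] ℝ) → E)
    (hinv_left : ∀ x : E, gstar (f' x) = x)
    (hinv_right : ∀ xs : E →L[ℝ] ℝ, f' (gstar xs) = xs)
    (z : E) (N : ℕ) (x : Fin N → E) (t : Fin N → ℝ)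
    (ht_nonneg : ∀ i, 0 ≤ t i) (ht_sum : ∑ i, t i = 1) :
    D z (gstar (∑ i, t i • f' (x i))) ≤ ∑ i, t i * D z (x i) := by
  have hterm (w : E) (i : Fin N) :
      t i * (f z - f w - f' (x i) (z - w)) ≤ t i * D z (x i) := by
    refine mul_le_mul_of_nonneg_left ?_ (ht_nonneg i)
    have h := hconv.add_fderiv_le (hdiff (x i)) w
    simp only [hD, map_sub] at h ⊢
    linarith
  set w := gstar (∑ i, t i • f' (x i)) with hw
  calc D z w = ∑ i, t i * (f z - f w - f' (x i) (z - w)) := by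
        rw [hD, hw, hinv_right, ← hw]
        simp only [mul_sub, Finset.sum_sub_distrib, ← Finset.sum_mul, ht_sum, one_mul,
          sum_apply, smul_apply, smul_eq_mul]
    _ ≤ ∑ i, t i * D z (x i) := Finset.sum_le_sum fun i _ => hterm w i
end

section
/- Maingé's lemma: let (a_n) be a sequence of real numbers such that there exists a strictly increasing sequence of indices (n_i) with a_{n_i} < a_{n_i + 1} for all i ∈ ℕ. Define m_k := max{j ≤ k : a_j < a_{j+1}} (for all sufficiently large k for which this set is nonempty). Then (m_k) is a nondecreasing sequence with m_k → ∞ as k → ∞, and for all sufficiently large k one has a_{m_k} ≤ a_{m_k + 1} and a_k ≤ a_{m_k + 1}. -/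
open Filter Topology

/-- Maingé's lemma: let `(a_n)` be a sequence of reals such that there is a strictly
increasing sequence of indices `(n_i)` with `a_{n_i} < a_{n_i + 1}` for all `i`.
Then the sequence `m_k := max {j ≤ k : a_j < a_{j+1}}` (defined for all sufficiently
large `k`) is nondecreasing, tends to `∞`, and for all sufficiently large `k` one
has `a_{m_k} ≤ a_{m_k + 1}` and `a_k ≤ a_{m_k + 1}`. -/
theorem mainge_lemma
    (a : ℕ → ℝ) (n : ℕ → ℕ) (hn : StrictMono n)
    (hinc : ∀ i : ℕ, a (n i) < a (n i + 1)) :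
    ∃ m : ℕ → ℕ, Monotone m ∧ Tendsto m atTop atTop ∧
      ∀ᶠ k in atTop,
        IsGreatest {j : ℕ | j ≤ k ∧ a j < a (j + 1)} (m k) ∧
        a (m k) ≤ a (m k + 1) ∧ a k ≤ a (m k + 1) := by
  classical
  have hmono : Monotone (Nat.findGreatest fun j => a j < a (j + 1)) :=
    fun _ _ h => Nat.findGreatest_mono_right _ h
  refine ⟨Nat.findGreatest fun j => a j < a (j + 1), hmono, ?_, ?_⟩
  · refine tendsto_atTop_atTop_of_monotone hmono fun b => ⟨n b, ?_⟩
    exact (hn.id_le b).trans (Nat.le_findGreatest le_rfl (hinc b))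
  · filter_upwards [eventually_ge_atTop (n 0)] with k hk
    have hspec := Nat.findGreatest_spec (P := fun j => a j < a (j + 1)) hk (hinc 0)
    have hle := Nat.findGreatest_le (P := fun j => a j < a (j + 1)) k
    have hmax : ∀ j ≤ k, a j < a (j + 1) →
        j ≤ Nat.findGreatest (fun j => a j < a (j + 1)) k :=
      fun _ hj h => Nat.le_findGreatest hj h
    generalize Nat.findGreatest (fun j => a j < a (j + 1)) k = m at hspec hle hmax ⊢
    refine ⟨⟨⟨hle, hspec⟩, fun j hj => hmax j hj.1 hj.2⟩, hspec.le, ?_⟩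
    obtain rfl | hlt := hle.eq_or_lt
    · exact hspec.le
    · have hdesc : ∀ l, m + 1 ≤ l → l ≤ k → a l ≤ a (m + 1) := by
        intro l hl
        induction l, hl using Nat.le_induction with
        | base => exact fun _ => le_rfl
        | succ l hl ih =>
          intro hlk
          have hstep : a (l + 1) ≤ a l := by
            by_contra! h
            have := hmax l (by omega) h
            omega
          exact hstep.trans (ih (by omega))
      exact hdesc k hlt le_rfl
end

section
/- The resolvent is Bregman firmly nonexpansive: let C be a nonempty closed convex subset of E and let g : C × C → ℝ satisfy conditions (A1)–(A4). If x, x' ∈ E and z, w ∈ C satisfy g(z,y) + ⟨∇f(z) − ∇f(x), y − z⟩ ≥ 0 for all y ∈ C and g(w,y) + ⟨∇f(w) − ∇f(x'), y − w⟩ ≥ 0 for all y ∈ C, then ⟨∇f(z) − ∇f(w), z − w⟩ ≤ ⟨∇f(x) − ∇f(x'), z − w⟩. -/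
open Filter Topology

/-- The resolvent is Bregman firmly nonexpansive: let `C` be a nonempty closed convex
subset of a reflexive space `E` and let `g : C × C → ℝ` satisfy (A1)–(A4).  If
`z, w ∈ C` satisfy the resolvent inequalities with respect to `x, x' ∈ E`
respectively, then `⟨∇f(z) − ∇f(w), z − w⟩ ≤ ⟨∇f(x) − ∇f(x'), z − w⟩`. -/
theorem resolvent_bregman_firmly_nonexpansive
    {E : Type*} [NormedAddCommGroup E] [NormedSpace ℝ E] [CompleteSpace E]
    (hrefl : Function.Surjective (NormedSpace.inclusionInDoubleDual ℝ E))
    (f : E → ℝ) (f' : E → (E →L[ℝ] ℝ))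
    (hconv : ConvexOn ℝ Set.univ f)
    (hdiff : ∀ x : E, HasFDerivAt f (f' x) x)
    (C : Set E) (hCne : C.Nonempty) (hCclosed : IsClosed C) (hCconv : Convex ℝ C)
    (g : E → E → ℝ)
    (hA1 : ∀ x ∈ C, g x x = 0)
    (hA2 : ∀ x ∈ C, ∀ y ∈ C, g x y + g y x ≤ 0)
    (hA3 : ∀ x ∈ C, ∀ z ∈ C, ∀ y ∈ C,
      limsup (fun t : ℝ => g (x + t • (z - x)) y) (𝓝[>] (0:ℝ)) ≤ g x y)
    (hA4 : ∀ x ∈ C, ConvexOn ℝ C (g x) ∧ LowerSemicontinuousOn (g x) C)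
    (x x' : E) (z w : E) (hz : z ∈ C) (hw : w ∈ C)
    (hzres : ∀ y ∈ C, g z y + (f' z - f' x) (y - z) ≥ 0)
    (hwres : ∀ y ∈ C, g w y + (f' w - f' x') (y - w) ≥ 0) :
    (f' z - f' w) (z - w) ≤ (f' x - f' x') (z - w) := by
  have hzw := hzres w hw
  have hwz := hwres z hz
  have hmono := hA2 z hz w hw
  simp only [sub_apply, map_sub] at hzw hwz ⊢
  linarith
end

section
/- Resolvent inequality with respect to equilibrium solutions: let C be a nonempty closed convex subset of E and let g : C × C → ℝ satisfy conditions (A1)–(A4). Let x ∈ E and let z ∈ C satisfy g(z,y) + ⟨∇f(z) − ∇f(x), y − z⟩ ≥ 0 for all y ∈ C. Then for every q ∈ EP(g) (i.e., q ∈ C with g(q,y) ≥ 0 for all y ∈ C), one has D_f(q, z) + D_f(z, x) ≤ D_f(q, x). -/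
open Filter Topology

/-- Resolvent inequality with respect to equilibrium solutions: let `C` be a nonempty
closed convex subset of a reflexive space `E` and let `g : C × C → ℝ` satisfy
(A1)–(A4).  If `z ∈ C` satisfies the resolvent inequality with respect to `x ∈ E`,
then for every `q ∈ EP(g)` one has `D_f(q, z) + D_f(z, x) ≤ D_f(q, x)`. -/
theorem resolvent_inequality_EP
    {E : Type*} [NormedAddCommGroup E] [NormedSpace ℝ E] [CompleteSpace E]
    (hrefl : Function.Surjective (NormedSpace.inclusionInDoubleDual ℝ E))
    (f : E → ℝ) (f' : E → (E →L[ℝ] ℝ))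
    (hconv : ConvexOn ℝ Set.univ f)
    (hdiff : ∀ x : E, HasFDerivAt f (f' x) x)
    (D : E → E → ℝ)
    (hD : ∀ y x : E, D y x = f y - f x - f' x (y - x))
    (C : Set E) (hCne : C.Nonempty) (hCclosed : IsClosed C) (hCconv : Convex ℝ C)
    (g : E → E → ℝ)
    (hA1 : ∀ x ∈ C, g x x = 0)
    (hA2 : ∀ x ∈ C, ∀ y ∈ C, g x y + g y x ≤ 0)
    (hA3 : ∀ x ∈ C, ∀ z ∈ C, ∀ y ∈ C,
      limsup (fun t : ℝ => g (x + t • (z - x)) y) (𝓝[>] (0:ℝ)) ≤ g x y)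
    (hA4 : ∀ x ∈ C, ConvexOn ℝ C (g x) ∧ LowerSemicontinuousOn (g x) C)
    (x : E) (z : E) (hz : z ∈ C)
    (hzres : ∀ y ∈ C, g z y + (f' z - f' x) (y - z) ≥ 0)
    (q : E) (hqC : q ∈ C) (hqEP : ∀ y ∈ C, 0 ≤ g q y) :
    D q z + D z x ≤ D q x := by
  have hres := hzres q hqC
  have hmono := hA2 z hz q hqC
  have hq := hqEP z hz
  have hsplit : f' x (q - x) = f' x (q - z) + f' x (z - x) := by
    rw [← map_add, sub_add_sub_cancel]
  rw [sub_apply] at hres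
  rw [hD, hD, hD, hsplit]
  linarith
end
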